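/- Let f ∈ M be nonzero with f ≤_M f0 and let h ∈ L_f be nonzero. Then I_f(h) is an interval in N_f; that is, I_f(h) is nonempty, hereditary (g ∈ N_f, g ≤_M g' and g' ∈ I_f(h) imply g ∈ I_f(h)), and upward directed (for g1, g2 ∈ I_f(h) there exists g ∈ I_f(h) with g1 ≤_M g and g2 ≤_M g). -/

import Mathlib

open Topology Set Pointwise

/-- A countable subgroup of `C(X, ℝ)` with properties (i)-(iv) from the paper. -/
structure GoodGroup (X : Type*) [TopologicalSpace X] (t0 : X) where
  G : AddSubgroup C(X, ℝ)
  countable : (G : Set C(X, ℝ)).Countable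
  sup_mem : ∀ f g : C(X, ℝ), f ∈ G → g ∈ G → f ⊔ g ∈ G
  inf_mem : ∀ f g : C(X, ℝ), f ∈ G → g ∈ G → f ⊓ g ∈ G
  rat_smul_mem : ∀ (q : ℚ) (f : C(X, ℝ)), f ∈ G → (q : ℝ) • f ∈ G
  f0 : C(X, ℝ)
  f0_mem : f0 ∈ G
  f0_nonneg : ∀ t, 0 ≤ f0 t
  f0_le_one : ∀ t, f0 t ≤ 1
  f0_zero : f0 t0 = 0
  f0_pos : ∀ t, t ≠ t0 → 0 < f0 t
  loc_affine : ∀ f ∈ G, ∃ V : Set X, IsOpen V ∧ t0 ∈ V ∧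
      ∃ lam mu : ℚ, ∀ t ∈ V, f t = (lam : ℝ) + (mu : ℝ) * f0 t
  urysohn : ∀ K V : Set X, IsClosed K → IsOpen V → K ⊆ V → ∀ ρ : ℚ, 0 ≤ ρ →
      ∃ U : Set X, IsOpen U ∧ K ⊆ U ∧ U ⊆ V ∧ ∃ r ∈ G,
        (∀ t, 0 ≤ r t ∧ r t ≤ (ρ : ℝ)) ∧ (∀ t ∈ U, r t = (ρ : ℝ)) ∧
        ∀ t, t ∉ V → r t = 0

variable {X : Type*} [TopologicalSpace X] {t0 : X}

/-- The monoid `M`: `0` together with all nonnegative `f ∈ G` which are strictly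
positive on some punctured neighbourhood of `t0`. -/
def Mset (gg : GoodGroup X t0) : Set C(X, ℝ) :=
  {f | f = 0 ∨ (f ∈ gg.G ∧ (∀ t, 0 ≤ f t) ∧
      ∃ V : Set X, IsOpen V ∧ t0 ∈ V ∧ ∀ t ∈ V, t ≠ t0 → 0 < f t)}

/-- The algebraic order on `M`. -/
def leM (gg : GoodGroup X t0) (g h : C(X, ℝ)) : Prop :=
  ∃ z ∈ Mset gg, h = g + z

/-- The strict algebraic order on `M`. -/
def ltM (gg : GoodGroup X t0) (g h : C(X, ℝ)) : Prop :=
  leM gg g h ∧ g ≠ h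

/-- The order-ideal `N_f` generated by `f`. -/
def Nf (gg : GoodGroup X t0) (f : C(X, ℝ)) : Set C(X, ℝ) :=
  {g ∈ Mset gg | ∃ n : ℕ, 1 ≤ n ∧ leM gg g (n • f)}

/-- The canonical interval `D_f`. -/
def Df (gg : GoodGroup X t0) (f : C(X, ℝ)) : Set C(X, ℝ) :=
  {g ∈ Nf gg f | leM gg g 1}

/-- The co-zero set `U_f` of `f`. -/
def Uf (f : C(X, ℝ)) : Set X := {t | f t ≠ 0}

/-- An order-ideal of `M`: a submonoid hereditary w.r.t. the algebraic order. -/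
def IsOrderIdeal (gg : GoodGroup X t0) (O : Set C(X, ℝ)) : Prop :=
  O ⊆ Mset gg ∧ (0 : C(X, ℝ)) ∈ O ∧ (∀ a ∈ O, ∀ b ∈ O, a + b ∈ O) ∧
  ∀ g ∈ Mset gg, ∀ h ∈ O, leM gg g h → g ∈ O

/-- An interval in `N_f`: a nonempty, hereditary, upward directed subset. -/
def IsInterval (gg : GoodGroup X t0) (f : C(X, ℝ)) (E : Set C(X, ℝ)) : Prop :=
  E.Nonempty ∧ E ⊆ Nf gg f ∧
  (∀ g ∈ Nf gg f, ∀ g' ∈ E, leM gg g g' → g ∈ E) ∧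
  ∀ g1 ∈ E, ∀ g2 ∈ E, ∃ g ∈ E, leM gg g1 g ∧ leM gg g2 g

/-- The `n`-fold sum `E + ⋯ + E` of a set of functions. -/
def nFold (n : ℕ) (E : Set C(X, ℝ)) : Set C(X, ℝ) :=
  {x | ∃ y : Fin n → C(X, ℝ), (∀ i, y i ∈ E) ∧ x = ∑ i, y i}

/-- A complemented interval in `N_f` (with respect to `D_f`). -/
def IsCompInterval (gg : GoodGroup X t0) (f : C(X, ℝ)) (E : Set C(X, ℝ)) : Prop :=
  IsInterval gg f E ∧ ∃ F : Set C(X, ℝ), IsInterval gg f F ∧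
    ∃ k : ℕ, 1 ≤ k ∧ E + F = nFold k (Df gg f)

/-- `h` is a nonzero element of `L_f`: a nonnegative bounded continuous function
on `U_f` admitting a nonzero minorant in `N_f`. -/
def MemLfNZ (gg : GoodGroup X t0) (f : C(X, ℝ)) (h : X → ℝ) : Prop :=
  ContinuousOn h (Uf f) ∧ (∃ C : ℝ, ∀ t ∈ Uf f, h t ≤ C) ∧
  (∀ t ∈ Uf f, 0 ≤ h t) ∧
  ∃ z ∈ Nf gg f, z ≠ (0 : C(X, ℝ)) ∧ ∀ t ∈ Uf f, z t ≤ h t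

/-- `h` belongs to `L_f` (either `0` on `U_f`, or has a nonzero minorant in `N_f`). -/
def MemLf (gg : GoodGroup X t0) (f : C(X, ℝ)) (h : X → ℝ) : Prop :=
  ContinuousOn h (Uf f) ∧ (∃ C : ℝ, ∀ t ∈ Uf f, h t ≤ C) ∧
  (∀ t ∈ Uf f, 0 ≤ h t) ∧
  ((∀ t ∈ Uf f, h t = 0) ∨ ∃ z ∈ Nf gg f, z ≠ (0 : C(X, ℝ)) ∧ ∀ t ∈ Uf f, z t ≤ h t)

/-- The interval `I_f(h)` associated with `h ∈ L_f`. -/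
def Iset (gg : GoodGroup X t0) (f : C(X, ℝ)) (h : X → ℝ) : Set C(X, ℝ) :=
  {g | g = 0 ∨ (g ∈ Nf gg f ∧ ∃ z ∈ Nf gg f, ltM gg g z ∧
      (∀ t ∈ Uf f, z t ≤ h t) ∧
      ∃ V : Set X, IsOpen V ∧ t0 ∈ V ∧ ∀ t ∈ (V \ {t0}) ∩ Uf f, z t < h t)}

/-- Property (C) for a nonzero element of `L_f`. -/
def PropC (gg : GoodGroup X t0) (f : C(X, ℝ)) (h : X → ℝ) : Prop :=
  ∀ t ∈ Uf f, t ≠ t0 → ∃ z ∈ Nf gg f,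
    (∀ s ∈ Uf f, z s ≤ h s) ∧
    (∃ W : Set X, IsOpen W ∧ t ∈ W ∧ ∀ s ∈ W ∩ Uf f, z s = h s) ∧
    ∃ V : Set X, IsOpen V ∧ t0 ∈ V ∧ ∀ s ∈ (V \ {t0}) ∩ Uf f, z s < h s


def PosM (gg : GoodGroup X t0) (f : C(X, ℝ)) : Prop :=
  f ∈ gg.G ∧ (∀ t, 0 ≤ f t) ∧
      ∃ V : Set X, IsOpen V ∧ t0 ∈ V ∧ ∀ t ∈ V, t ≠ t0 → 0 < f t

lemma Mset.memG {gg : GoodGroup X t0} {f : C(X, ℝ)} (h : f ∈ Mset gg) : f ∈ gg.G := by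
  rcases h with rfl | h
  · exact gg.G.zero_mem
  · exact h.1

lemma Mset.nonneg {gg : GoodGroup X t0} {f : C(X, ℝ)} (h : f ∈ Mset gg) (t : X) : 0 ≤ f t := by
  rcases h with rfl | h
  · simp
  · exact h.2.1 t

lemma Mset.pos {gg : GoodGroup X t0} {f : C(X, ℝ)} (h : f ∈ Mset gg) (h0 : f ≠ 0) :
    PosM gg f := by
  rcases h with h | h
  · exact absurd h h0
  · exact h

lemma PosM.mem {gg : GoodGroup X t0} {f : C(X, ℝ)} (h : PosM gg f) : f ∈ Mset gg := Or.inr h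

lemma PosM.ne (ht0 : Filter.NeBot (𝓝[≠] t0)) {gg : GoodGroup X t0} {f : C(X, ℝ)}
    (h : PosM gg f) : f ≠ 0 := by
  rintro rfl
  obtain ⟨-, -, V, hV, h0, hp⟩ := h
  have h1 : ∀ᶠ t in 𝓝[≠] t0, t ∈ V := nhdsWithin_le_nhds (hV.mem_nhds h0)
  have h2 : ∀ᶠ t in 𝓝[≠] t0, t ≠ t0 := self_mem_nhdsWithin
  obtain ⟨t, ht, ht'⟩ := (h1.and h2).exists
  simpa using hp t ht ht'

/-- anything in `G` dominating a positive element is positive. -/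
lemma PosM.of_le {gg : GoodGroup X t0} {f g : C(X, ℝ)} (h : PosM gg f) (hg : g ∈ gg.G)
    (hle : ∀ t, f t ≤ g t) : PosM gg g := by
  obtain ⟨-, hn, V, hV, h0, hp⟩ := h
  exact ⟨hg, fun t => (hn t).trans (hle t), V, hV, h0,
    fun t ht hne => (hp t ht hne).trans_le (hle t)⟩

lemma PosM.inf {gg : GoodGroup X t0} {f g : C(X, ℝ)} (hf : PosM gg f) (hg : PosM gg g) :
    PosM gg (f ⊓ g) := by
  obtain ⟨a, hn, V, hV, h0, hp⟩ := hf
  obtain ⟨a', hn', V', hV', h0', hp'⟩ := hg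
  refine ⟨gg.inf_mem _ _ a a', fun t => ?_, V ∩ V', hV.inter hV', ⟨h0, h0'⟩, fun t ht hne => ?_⟩
  · simpa using ⟨hn t, hn' t⟩
  · simpa using ⟨hp t ht.1 hne, hp' t ht.2 hne⟩

lemma PosM.half {gg : GoodGroup X t0} {f : C(X, ℝ)} (hf : PosM gg f) :
    PosM gg (((1/2 : ℚ) : ℝ) • f) := by
  obtain ⟨a, hn, V, hV, h0, hp⟩ := hf
  refine ⟨gg.rat_smul_mem _ _ a, fun t => ?_, V, hV, h0, fun t ht hne => ?_⟩
  · have := hn t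
    simp; linarith
  · have := hp t ht hne
    simp; linarith

lemma Mset.add {gg : GoodGroup X t0} {f g : C(X, ℝ)} (hf : f ∈ Mset gg) (hg : g ∈ Mset gg) :
    f + g ∈ Mset gg := by
  by_cases h0 : f = 0
  · simpa [h0] using hg
  · refine ((Mset.pos hf h0).of_le (gg.G.add_mem (Mset.memG hf) (Mset.memG hg)) fun t => ?_).mem
    have := Mset.nonneg hg t
    simp; linarith

variable [CompactSpace X] [TopologicalSpace.MetrizableSpace X] [Infinite X]

/-- `I_f(h)` is an interval in `N_f`. -/
theorem statement_4 (ht0 : Filter.NeBot (𝓝[≠] t0)) (gg : GoodGroup X t0)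
    (f : C(X, ℝ)) (hfM : f ∈ Mset gg) (hf : f ≠ 0) (hff0 : leM gg f gg.f0)
    (h : X → ℝ) (hh : MemLfNZ gg f h) :
    (Iset gg f h).Nonempty ∧
    (∀ g ∈ Nf gg f, ∀ g' ∈ Iset gg f h, leM gg g g' → g ∈ Iset gg f h) ∧
    (∀ g1 ∈ Iset gg f h, ∀ g2 ∈ Iset gg f h,
      ∃ g ∈ Iset gg f h, leM gg g1 g ∧ leM gg g2 g) := by
  have hfP := Mset.pos hfM hf
  refine ⟨⟨0, Or.inl rfl⟩, ?_, ?_⟩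
  · rintro g hg g' hg' ⟨w, hw, rfl⟩
    rcases hg' with h0 | ⟨hg', z, hz, ⟨⟨w', hw', rfl⟩, hne⟩, hzh⟩
    · left
      ext t
      have h1 := Mset.nonneg hg.1 t
      have h2 := Mset.nonneg hw t
      have h3 := DFunLike.congr_fun h0 t
      simp at h3 ⊢
      linarith
    · right
      have hw0 : w' ≠ 0 := by
        rintro rfl
        simp at hne
      have hP : PosM gg (w + w') := (Mset.pos hw' hw0).of_le (gg.G.add_mem (Mset.memG hw) (Mset.memG hw'))
        fun t => by have := Mset.nonneg hw t; simp; linarith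
      refine ⟨hg, _, hz, ⟨⟨w + w', hP.mem, add_assoc _ _ _⟩, fun hc => ?_⟩, hzh⟩
      rw [add_assoc] at hc
      exact hP.ne ht0 (by simpa using hc.symm)
  · rintro g1 hg1 g2 hg2
    rcases hg1 with rfl | ⟨hg1, z1, hz1, ⟨⟨w1, hw1, e1⟩, hne1⟩, hle1, V1, hV1, h01, hlt1⟩
    · refine ⟨g2, hg2, ⟨g2, ?_, by simp⟩, ⟨0, Or.inl rfl, by simp⟩⟩
      rcases hg2 with h | h
      · exact Or.inl h
      · exact h.1.1
    rcases hg2 with rfl | ⟨hg2, z2, hz2, ⟨⟨w2, hw2, e2⟩, hne2⟩, hle2, V2, hV2, h02, hlt2⟩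
    · exact ⟨g1, Or.inr ⟨hg1, z1, hz1, ⟨⟨w1, hw1, e1⟩, hne1⟩, hle1, V1, hV1, h01, hlt1⟩,
        ⟨0, Or.inl rfl, by simp⟩, ⟨g1, hg1.1, by simp⟩⟩
    have P1 : PosM gg w1 := Mset.pos hw1 (by rintro rfl; simp at e1; exact hne1 e1.symm)
    have P2 : PosM gg w2 := Mset.pos hw2 (by rintro rfl; simp at e2; exact hne2 e2.symm)
    have Gg := gg.sup_mem _ _ (Mset.memG hg1.1) (Mset.memG hg2.1)
    have Gz := gg.sup_mem _ _ (Mset.memG hz1.1) (Mset.memG hz2.1)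
    have e1t : ∀ t, z1 t = g1 t + w1 t := fun t => by rw [e1]; rfl
    have e2t : ∀ t, z2 t = g2 t + w2 t := fun t => by rw [e2]; rfl
    have PD : PosM gg (z1 ⊔ z2 - g1 ⊔ g2) := by
      refine (P1.inf P2).of_le (gg.G.sub_mem Gz Gg) fun t => ?_
      have := e1t t
      have := e2t t
      simp only [ContinuousMap.inf_apply, ContinuousMap.sub_apply, ContinuousMap.sup_apply]
      grind
    have PH := PD.half
    have Pz : z1 ⊔ z2 ∈ Mset gg := by
      refine (P1.of_le Gz fun t => ?_).mem
      have := e1t t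
      have := Mset.nonneg hg1.1 t
      simp only [ContinuousMap.sup_apply]
      exact le_trans (by linarith) (le_max_left _ _)
    obtain ⟨n1, hn1, y1, hy1, E1⟩ := hz1.2
    obtain ⟨n2, hn2, y2, hy2, E2⟩ := hz2.2
    have PF : PosM gg ((n1 + n2) • f - z1 ⊔ z2) := by
      refine hfP.of_le (gg.G.sub_mem (gg.G.nsmul_mem hfP.1 _) Gz) fun t => ?_
      have a1 := DFunLike.congr_fun E1 t
      have a2 := DFunLike.congr_fun E2 t
      have b1 := Mset.nonneg hy1 t
      have b2 := Mset.nonneg hy2 t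
      have hft := hfP.2.1 t
      have c1 : (1:ℝ) ≤ n1 := by exact_mod_cast hn1
      have c2 : (1:ℝ) ≤ n2 := by exact_mod_cast hn2
      have d1 : f t ≤ n1 * f t := by nlinarith
      have d2 : f t ≤ n2 * f t := by nlinarith
      simp at a1 a2
      have : z1 t ⊔ z2 t ≤ (n1 + n2) * f t - f t := by
        apply max_le <;> linarith
      simp
      linarith
    have hzN : z1 ⊔ z2 ∈ Nf gg f := ⟨Pz, n1 + n2, by omega, _, PF.mem, by abel⟩
    set H := ((1/2 : ℚ) : ℝ) • (z1 ⊔ z2 - g1 ⊔ g2) with hH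
    have Q1 : PosM gg (g1 ⊔ g2 + H - g1) := by
      refine PH.of_le (gg.G.sub_mem (gg.G.add_mem Gg PH.1) (Mset.memG hg1.1)) fun t => ?_
      have := le_max_left (g1 t) (g2 t)
      simp only [ContinuousMap.add_apply, ContinuousMap.sub_apply, ContinuousMap.sup_apply]
      linarith
    have Q2 : PosM gg (g1 ⊔ g2 + H - g2) := by
      refine PH.of_le (gg.G.sub_mem (gg.G.add_mem Gg PH.1) (Mset.memG hg2.1)) fun t => ?_
      have := le_max_right (g1 t) (g2 t)
      simp only [ContinuousMap.add_apply, ContinuousMap.sub_apply, ContinuousMap.sup_apply]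
      linarith
    have hgM : g1 ⊔ g2 + H ∈ Mset gg := by
      have := Mset.add hg1.1 Q1.mem
      simpa using this
    have hzz : z1 ⊔ z2 = g1 ⊔ g2 + H + H := by
      ext t
      simp [hH]
      ring
    refine ⟨g1 ⊔ g2 + H, Or.inr ⟨⟨hgM, n1 + n2, by omega, H + ((n1 + n2) • f - z1 ⊔ z2),
      Mset.add PH.mem PF.mem, ?_⟩, z1 ⊔ z2, hzN, ⟨⟨H, PH.mem, hzz⟩, ?_⟩, ?_, V1 ∩ V2,
      hV1.inter hV2, ⟨h01, h02⟩, ?_⟩, ⟨_, Q1.mem, by abel⟩, ⟨_, Q2.mem, by abel⟩⟩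
    · rw [← add_assoc, ← hzz]; abel
    · intro hc
      rw [hzz] at hc
      exact PH.ne ht0 (by simpa using hc)
    · intro t ht
      exact max_le (hle1 t ht) (hle2 t ht)
    · rintro t ⟨⟨⟨ht1, ht2⟩, hn⟩, ht⟩
      exact max_lt (hlt1 t ⟨⟨ht1, hn⟩, ht⟩) (hlt2 t ⟨⟨ht2, hn⟩, ht⟩)
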